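/- Let r be an odd positive integer and let f : ℝ → ℝ be of class C^{r+1}. Suppose there exist T > 0 and m > 0 such that f^{(r+1)}(x) ≥ m whenever |x| > T. Then for every fixed s ∈ ℝ, P_c(s) → −∞ as |c| → ∞ (i.e., both as c → ∞ and as c → −∞), where P_c denotes the Taylor polynomial of order r of f centered at c. -/

import Mathlib

open Filter

/-- The Taylor polynomial of order `r` of `f` centered at `c`, as a function on `ℝ`. -/
noncomputable def taylorPoly (f : ℝ → ℝ) (r : ℕ) (c : ℝ) : ℝ → ℝ :=
  fun x => ∑ k ∈ Finset.range (r + 1), iteratedDeriv k f c / (k.factorial : ℝ) * (x - c) ^ k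

theorem taylorPoly_succ (f : ℝ → ℝ) (r : ℕ) (c x : ℝ) :
    taylorPoly f (r + 1) c x = taylorPoly f r c x +
      iteratedDeriv (r + 1) f c / ((r + 1).factorial : ℝ) * (x - c) ^ (r + 1) := by
  simp only [taylorPoly]
  rw [Finset.sum_range_succ]

/-- The derivative of the value of a Taylor polynomial with respect to its center. -/
theorem hasDerivAt_taylorPoly_center {f : ℝ → ℝ} {r : ℕ} (hf : ContDiff ℝ (r + 1 : ℕ) f)
    (s c : ℝ) :
    HasDerivAt (fun c => taylorPoly f r c s)
      (iteratedDeriv (r + 1) f c / (r.factorial : ℝ) * (s - c) ^ r) c := by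
  have key (n : ℕ) (hn : ContDiff ℝ (n + 1 : ℕ) f) :
      HasDerivAt (iteratedDeriv n f) (iteratedDeriv (n + 1) f c) c := by
    rw [iteratedDeriv_succ]
    exact ((hn.differentiable_iteratedDeriv n (by exact_mod_cast n.lt_succ_self)) c).hasDerivAt
  induction r with
  | zero => simpa [taylorPoly] using key 0 hf
  | succ n ih =>
    have h1 := ih (hf.of_le (by exact_mod_cast (n + 1).le_succ))
    have h2 := ((key (n + 1) hf).div_const ((n + 1).factorial : ℝ)).mul
      (((hasDerivAt_id c).const_sub s).pow (n + 1))
    simp only [taylorPoly_succ]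
    refine (h1.add h2).congr_deriv ?_
    have hn : (n.factorial : ℝ) ≠ 0 := by positivity
    have hn' : (n : ℝ) + 1 ≠ 0 := by positivity
    simp only [Nat.factorial_succ, Nat.add_sub_cancel, Pi.pow_apply, id]
    push_cast
    field_simp
    ring

/-- A function whose derivative is eventually at most a negative constant tends to `-∞`. -/
theorem tendsto_atBot_of_hasDerivAt_le {g g' : ℝ → ℝ} {A k : ℝ} (hk : 0 < k)
    (hg : ∀ x, HasDerivAt g (g' x) x) (hle : ∀ x, A < x → g' x ≤ -k) :
    Tendsto g atTop atBot := by
  have hbd : ∀ x, A ≤ x → g x ≤ g A + -k * (x - A) := by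
    intro x hx
    have hd : Differentiable ℝ g := fun y => (hg y).differentiableAt
    have := (convex_Ici A).image_sub_le_mul_sub_of_deriv_le hd.continuous.continuousOn
      hd.differentiableOn
      (fun y hy => by
        rw [interior_Ici] at hy
        rw [(hg y).deriv]
        exact hle y hy) A Set.self_mem_Ici x hx hx
    linarith
  refine tendsto_atBot_mono' atTop ((eventually_ge_atTop A).mono hbd) ?_
  refine tendsto_atBot_add_const_left _ _ ?_
  exact (tendsto_atTop_add_const_right _ (-A) tendsto_id).const_mul_atTop_of_neg (by linarith)

/-- **Lemma (Horwitz, Section 3).** Let `r` be an odd positive integer, `f ∈ C^{r+1}`, and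
suppose `f^{(r+1)} ≥ m > 0` outside `[-T, T]`. Then for any fixed `s`, `P_c(s) → -∞` as
`|c| → ∞`. -/
theorem taylor_value_tendsto_atBot
    (r : ℕ) (hr : Odd r) (hrpos : 0 < r)
    (f : ℝ → ℝ) (hf : ContDiff ℝ (r + 1 : ℕ) f)
    (T m : ℝ) (hT : 0 < T) (hm : 0 < m)
    (hbound : ∀ x : ℝ, T < |x| → m ≤ iteratedDeriv (r + 1) f x)
    (s : ℝ) :
    Tendsto (fun c : ℝ => taylorPoly f r c s) atTop atBot ∧
    Tendsto (fun c : ℝ => taylorPoly f r c s) atBot atBot := by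
  have hfac : (0 : ℝ) < r.factorial := by positivity
  have hk : 0 < m / (r.factorial : ℝ) := by positivity
  have hlow (c d : ℝ) (hc : T < |c|) (hd : 1 ≤ d) :
      m / (r.factorial : ℝ) ≤ iteratedDeriv (r + 1) f c / (r.factorial : ℝ) * d ^ r := by
    have h1 : m / (r.factorial : ℝ) ≤ iteratedDeriv (r + 1) f c / (r.factorial : ℝ) :=
      div_le_div_of_nonneg_right (hbound c hc) hfac.le
    exact h1.trans (le_mul_of_one_le_right (hk.le.trans h1) (one_le_pow₀ hd))
  have hderiv := hasDerivAt_taylorPoly_center hf s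
  constructor
  · refine tendsto_atBot_of_hasDerivAt_le (A := max T (s + 1)) hk hderiv fun c hc => ?_
    obtain ⟨hcT, hcs⟩ := max_lt_iff.mp hc
    have h := hlow c (c - s) (hcT.trans_le (le_abs_self c)) (by linarith)
    rw [← neg_sub c s, hr.neg_pow]
    linarith
  · have hneg : Tendsto (fun x : ℝ => taylorPoly f r (-x) s) atTop atBot := by
      refine tendsto_atBot_of_hasDerivAt_le (A := max T (1 - s)) hk
        (fun x => (hderiv (-x)).comp x (hasDerivAt_neg x)) fun x hx => ?_
      obtain ⟨hxT, hxs⟩ := max_lt_iff.mp hx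
      have h := hlow (-x) (s - -x) (by rw [abs_neg]; exact hxT.trans_le (le_abs_self x))
        (by linarith)
      linarith
    simpa [Function.comp_def] using hneg.comp tendsto_neg_atBot_atTop
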